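/- Let l be a natural number and m an integer with 0 ≤ m ≤ l. Define the Legendre polynomial Q_l(z) = (1/(2^l l!)) (d/dz)^l (z²−1)^l, the associated Legendre function Q_{l,m}(z) = (−1)^m (1−z²)^{m/2} (d/dz)^m Q_l(z) for |z| < 1, and the spherical harmonic Y_{l,m}(θ,φ) = sqrt(((2l+1)/(4π)) · ((l−m)!/(l+m)!)) · Q_{l,m}(cos θ) e^{imφ}. Then for every θ ∈ (0,π) and every φ ∈ ℝ, the spherical Laplace–Beltrami operator applied to Y_{l,m} satisfies (1/sin²θ) ∂²Y_{l,m}/∂φ² + (1/sin θ) ∂/∂θ (sin θ ∂Y_{l,m}/∂θ) = −l(l+1) Y_{l,m}(θ,φ). -/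

import Mathlib

/-- The Legendre polynomial `Q_l(z) = (1/(2^l l!)) (d/dz)^l (z²−1)^l`
(Rodrigues formula). -/
noncomputable def legendreQ (l : ℕ) (z : ℝ) : ℝ :=
  (1 / (2 ^ l * (Nat.factorial l : ℝ))) * iteratedDeriv l (fun w : ℝ => (w ^ 2 - 1) ^ l) z

/-- The associated Legendre function
`Q_{l,m}(z) = (−1)^m (1−z²)^{m/2} (d/dz)^m Q_l(z)`. -/
noncomputable def assocLegendre (l m : ℕ) (z : ℝ) : ℝ :=
  (-1 : ℝ) ^ m * (1 - z ^ 2) ^ ((m : ℝ) / 2) * iteratedDeriv m (legendreQ l) z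

/-- The spherical harmonic
`Y_{l,m}(θ,φ) = sqrt(((2l+1)/(4π)) ((l−m)!/(l+m)!)) Q_{l,m}(cos θ) e^{imφ}`
for `0 ≤ m ≤ l`. -/
noncomputable def sphericalHarmonic (l m : ℕ) (θ φ : ℝ) : ℂ :=
  (↑(Real.sqrt ((2 * l + 1) / (4 * Real.pi) *
        ((Nat.factorial (l - m) : ℝ) / (Nat.factorial (l + m)))) *
      assocLegendre l m (Real.cos θ)) : ℂ) * Complex.exp (Complex.I * m * φ)

open Polynomial in
/-- The Rodrigues polynomial `(X² - 1)^l` and its derivatives satisfy Gegenbauer's equation. -/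
theorem iterate_derivative_sq_sub_one_pow_ode (l n : ℕ) (z : ℝ) :
    (z ^ 2 - 1) * (derivative^[n + 2] ((X ^ 2 - 1 : ℝ[X]) ^ l)).eval z +
      2 * (n + 1 - l) * z * (derivative^[n + 1] ((X ^ 2 - 1 : ℝ[X]) ^ l)).eval z +
      (n + 1) * (n - 2 * l) * (derivative^[n] ((X ^ 2 - 1 : ℝ[X]) ^ l)).eval z = 0 := by
  set U : ℝ[X] := (X ^ 2 - 1) ^ l with hU
  have first : (X ^ 2 - 1) * derivative U = C (2 * (l : ℝ)) * X * U := by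
    cases l with
    | zero => simp [hU]
    | succ k =>
      simp only [hU, derivative_pow, derivative_sub, derivative_X, derivative_one, C_mul,
        Nat.add_sub_cancel, map_natCast, map_ofNat]
      push_cast
      ring
  have ode : (X ^ 2 - 1) * derivative^[n + 2] U +
      C (2 * ((n : ℝ) + 1 - l)) * X * derivative^[n + 1] U +
      C (((n : ℝ) + 1) * (n - 2 * l)) * derivative^[n] U = 0 := by
    induction n with
    | zero =>
      have h := congrArg derivative first
      simp only [derivative_mul, derivative_sub, derivative_pow, derivative_X, derivative_one,
        derivative_natCast, derivative_ofNat, Function.iterate_succ, Function.iterate_zero, Function.comp_apply, id,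
        C_mul, C_sub, C_add, C_1, map_natCast, map_ofNat] at h ⊢
      push_cast at h ⊢
      linear_combination h
    | succ n ih =>
      have h := congrArg derivative ih
      simp only [derivative_mul, derivative_sub, derivative_add, derivative_pow, derivative_X,
        derivative_one, derivative_natCast, derivative_ofNat, derivative_zero,
        ← Function.iterate_succ_apply' derivative,
        C_mul, C_sub, C_add, C_1, map_natCast, map_ofNat] at h ⊢
      push_cast at h ⊢
      linear_combination h
  simpa using congrArg (eval z) ode

/-- Iterated derivatives of a polynomial function are given by formal derivatives. -/
theorem iteratedDeriv_polynomial_eval (n : ℕ) (p : Polynomial ℝ) :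
    iteratedDeriv n (fun x => p.eval x) = fun x => (Polynomial.derivative^[n] p).eval x := by
  induction n with
  | zero => simp
  | succ n ih =>
    rw [iteratedDeriv_succ, ih]
    ext x
    rw [Polynomial.deriv, Function.iterate_succ_apply']

open Polynomial in
theorem legendreQ_eq_eval (l : ℕ) :
    legendreQ l = fun z => (C (1 / (2 ^ l * (Nat.factorial l : ℝ))) *
      derivative^[l] ((X ^ 2 - 1 : ℝ[X]) ^ l)).eval z := by
  ext z
  have h := congrFun (iteratedDeriv_polynomial_eval l ((X ^ 2 - 1 : ℝ[X]) ^ l)) z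
  simp only [eval_pow, eval_sub, eval_X, eval_one] at h
  simp [legendreQ, h]

open Polynomial in
theorem assocLegendre_cos (l m : ℕ) {s : ℝ} (hs : 0 < Real.sin s) :
    assocLegendre l m (Real.cos s) = (-1) ^ m * (1 / (2 ^ l * (Nat.factorial l : ℝ))) *
      (Real.sin s ^ m * (derivative^[l + m] ((X ^ 2 - 1 : ℝ[X]) ^ l)).eval (Real.cos s)) := by
  have hpow : (1 - Real.cos s ^ 2) ^ ((m : ℝ) / 2) = Real.sin s ^ m := by
    rw [← Real.sin_sq, ← Real.rpow_natCast, ← Real.rpow_mul hs.le, Nat.cast_ofNat,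
      mul_div_cancel₀ _ two_ne_zero, Real.rpow_natCast]
  rw [assocLegendre, hpow, legendreQ_eq_eval, iteratedDeriv_polynomial_eval,
    iterate_derivative_C_mul]
  simp only [← Function.iterate_add_apply, eval_mul, eval_C, add_comm m l]
  ring

theorem hasDerivAt_sin_pow_of_ne_zero (m : ℕ) {s : ℝ} (hs : Real.sin s ≠ 0) :
    HasDerivAt (fun t => Real.sin t ^ m) (m * Real.sin s ^ m * Real.cos s / Real.sin s) s := by
  refine ((Real.hasDerivAt_sin s).pow m).congr_deriv ?_
  cases m with
  | zero => simp
  | succ k =>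
    simp only [Nat.add_sub_cancel]
    field_simp
    ring

theorem hasDerivAt_polynomial_eval_cos (p : Polynomial ℝ) (s : ℝ) :
    HasDerivAt (fun t => p.eval (Real.cos t)) (-(p.derivative.eval (Real.cos s) * Real.sin s)) s := by
  exact ((p.hasDerivAt (Real.cos s)).comp s (Real.hasDerivAt_cos s)).congr_deriv (by ring)

theorem hasDerivAt_sin_pow_mul_eval_cos (m : ℕ) (p : Polynomial ℝ) {s : ℝ}
    (hs : Real.sin s ≠ 0) :
    HasDerivAt (fun t => Real.sin t ^ m * p.eval (Real.cos t))
      ((m * (Real.sin s ^ m * (Real.cos s * p.eval (Real.cos s))) -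
        Real.sin s ^ (m + 2) * p.derivative.eval (Real.cos s)) / Real.sin s) s := by
  refine ((hasDerivAt_sin_pow_of_ne_zero m hs).mul
    (hasDerivAt_polynomial_eval_cos p s)).congr_deriv ?_
  field_simp
  ring

theorem hasDerivAt_sin_mul_deriv_sin_pow_mul_eval_cos (m : ℕ) (p : Polynomial ℝ) {s : ℝ}
    (hs : Real.sin s ≠ 0) :
    HasDerivAt (fun t => m * (Real.sin t ^ m * (Real.cos t * p.eval (Real.cos t))) -
        Real.sin t ^ (m + 2) * p.derivative.eval (Real.cos t))
      (Real.sin s * Real.sin s ^ m *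
        ((m ^ 2 / Real.sin s ^ 2 - m ^ 2 - m) * p.eval (Real.cos s) -
          2 * (m + 1) * Real.cos s * p.derivative.eval (Real.cos s) +
          Real.sin s ^ 2 * p.derivative.derivative.eval (Real.cos s))) s := by
  refine ((((hasDerivAt_sin_pow_of_ne_zero m hs).mul ((Real.hasDerivAt_cos s).mul
    (hasDerivAt_polynomial_eval_cos p s))).const_mul (m : ℝ)).sub
    ((hasDerivAt_sin_pow_of_ne_zero (m + 2) hs).mul
      (hasDerivAt_polynomial_eval_cos p.derivative s))).congr_deriv ?_
  have h := Real.sin_sq_add_cos_sq s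
  simp only [Pi.mul_apply]
  push_cast
  field_simp
  linear_combination (m ^ 2 * Real.sin s ^ m * p.eval (Real.cos s)) * h

/-- For a natural number `l`, an integer `0 ≤ m ≤ l`, every
`θ ∈ (0,π)` and every `φ ∈ ℝ`, the spherical Laplace–Beltrami operator applied to
the spherical harmonic `Y_{l,m}` satisfies
`(1/sin²θ) ∂²Y_{l,m}/∂φ² + (1/sin θ) ∂/∂θ (sin θ ∂Y_{l,m}/∂θ) = −l(l+1) Y_{l,m}(θ,φ)`. -/
theorem laplace_beltrami_sphericalHarmonic (l m : ℕ) (hm : m ≤ l) (θ φ : ℝ)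
    (hθ : θ ∈ Set.Ioo 0 Real.pi) :
    ((1 / (Real.sin θ) ^ 2 : ℝ) : ℂ) *
        iteratedDeriv 2 (fun p : ℝ => sphericalHarmonic l m θ p) φ +
      ((1 / Real.sin θ : ℝ) : ℂ) *
        deriv (fun s : ℝ =>
          ((Real.sin s : ℝ) : ℂ) * deriv (fun s' : ℝ => sphericalHarmonic l m s' φ) s) θ =
      -((l : ℂ) * ((l : ℂ) + 1)) * sphericalHarmonic l m θ φ := by
  set W : Polynomial ℝ :=
    Polynomial.derivative^[l + m] ((Polynomial.X ^ 2 - 1 : Polynomial ℝ) ^ l) with hW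
  set K : ℝ := Real.sqrt ((2 * l + 1) / (4 * Real.pi) *
      ((Nat.factorial (l - m) : ℝ) / (Nat.factorial (l + m)))) *
    ((-1) ^ m * (1 / (2 ^ l * (Nat.factorial l : ℝ)))) with hK
  have hsin : 0 < Real.sin θ := Real.sin_pos_of_mem_Ioo hθ
  have hY : ∀ s ∈ Set.Ioo 0 Real.pi, ∀ p : ℝ, sphericalHarmonic l m s p =
      ((Real.sin s ^ m * W.eval (Real.cos s) : ℝ) : ℂ) *
        (K * Complex.exp (Complex.I * m * p)) := by
    intro s hs p
    rw [sphericalHarmonic, assocLegendre_cos l m (Real.sin_pos_of_mem_Ioo hs), hK]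
    push_cast
    ring
  have hφ : iteratedDeriv 2 (fun p : ℝ => sphericalHarmonic l m θ p) φ =
      -(m : ℂ) ^ 2 * sphericalHarmonic l m θ φ := by
    have hexp (p : ℝ) : HasDerivAt (fun q : ℝ => Complex.exp (Complex.I * m * q))
        (Complex.exp (Complex.I * m * p) * (Complex.I * m)) p := by
      simpa using ((Complex.ofRealCLM.hasDerivAt (x := p)).const_mul (Complex.I * m)).cexp
    have hd : deriv (fun p : ℝ => sphericalHarmonic l m θ p) =
        fun p : ℝ => sphericalHarmonic l m θ p * (Complex.I * m) := by
      ext p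
      simp only [sphericalHarmonic]
      rw [((hexp p).const_mul _).deriv]
      ring
    rw [iteratedDeriv_succ, iteratedDeriv_one, hd]
    simp only [sphericalHarmonic]
    rw [(((hexp φ).const_mul _).mul_const _).deriv]
    linear_combination (Complex.ofReal _ * Complex.exp (Complex.I * m * φ) * (m : ℂ) ^ 2) *
      Complex.I_sq
  have hθderiv : ∀ s ∈ Set.Ioo 0 Real.pi,
      ((Real.sin s : ℝ) : ℂ) * deriv (fun s' : ℝ => sphericalHarmonic l m s' φ) s =
      ((m * (Real.sin s ^ m * (Real.cos s * W.eval (Real.cos s))) -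
        Real.sin s ^ (m + 2) * W.derivative.eval (Real.cos s) : ℝ) : ℂ) *
        (K * Complex.exp (Complex.I * m * φ)) := by
    intro s hs
    have hs0 := (Real.sin_pos_of_mem_Ioo hs).ne'
    have heq : (fun s' : ℝ => sphericalHarmonic l m s' φ) =ᶠ[nhds s] _ :=
      Filter.eventuallyEq_of_mem (isOpen_Ioo.mem_nhds hs) fun t ht => hY t ht φ
    rw [heq.deriv_eq, ((hasDerivAt_sin_pow_mul_eval_cos m W hs0).ofReal_comp.mul_const _).deriv,
      ← mul_assoc, ← Complex.ofReal_mul, mul_div_cancel₀ _ hs0]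
  have heq : (fun s : ℝ => ((Real.sin s : ℝ) : ℂ) *
      deriv (fun s' : ℝ => sphericalHarmonic l m s' φ) s) =ᶠ[nhds θ] _ :=
    Filter.eventuallyEq_of_mem (isOpen_Ioo.mem_nhds hθ) hθderiv
  rw [hφ, heq.deriv_eq,
    ((hasDerivAt_sin_mul_deriv_sin_pow_mul_eval_cos m W hsin.ne').ofReal_comp.mul_const _).deriv,
    hY θ hθ φ]
  have key : 1 / Real.sin θ ^ 2 * (-(m : ℝ) ^ 2 * (Real.sin θ ^ m * W.eval (Real.cos θ))) +
      1 / Real.sin θ * (Real.sin θ * Real.sin θ ^ m *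
        ((m ^ 2 / Real.sin θ ^ 2 - m ^ 2 - m) * W.eval (Real.cos θ) -
          2 * (m + 1) * Real.cos θ * W.derivative.eval (Real.cos θ) +
          Real.sin θ ^ 2 * W.derivative.derivative.eval (Real.cos θ))) =
      -((l : ℝ) * (l + 1)) * (Real.sin θ ^ m * W.eval (Real.cos θ)) := by
    have ode := iterate_derivative_sq_sub_one_pow_ode l (l + m) (Real.cos θ)
    simp only [Function.iterate_succ_apply', ← hW] at ode
    push_cast at ode
    have hne := hsin.ne'
    have hs2 := Real.sin_sq_add_cos_sq θ
    field_simp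
    linear_combination (-(Real.sin θ ^ 2)) * ode +
      (Real.sin θ ^ 2 * W.derivative.derivative.eval (Real.cos θ)) * hs2
  have keyC := congrArg (fun x : ℝ => (x : ℂ) * (K * Complex.exp (Complex.I * m * φ))) key
  push_cast at keyC ⊢
  linear_combination keyC
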